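/- arXiv:0706.1738 — 3 statements merged into one kernel-verified Lean document; each statement's English description precedes it below -/
import Mathlib

section
/- Let n be a positive integer and J a subset of [n−1]. If σ is a permutation of [n] with DES σ = J, then fix σ ≤ n − |J|. -/
/-- The value of a permutation of `[n] = {1, …, n}` at `i`, in 1-based terms:
for `1 ≤ i ≤ n` this is `σ(i) ∈ {1, …, n}`; outside `[n]` we return `i`. -/
def permToFun {n : ℕ} (σ : Equiv.Perm (Fin n)) (i : ℕ) : ℕ :=
  if h : 1 ≤ i ∧ i ≤ n then ((σ ⟨i - 1, by omega⟩ : Fin n) : ℕ) + 1 else i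

/-- `fix σ`: the number of fixed points of a permutation of `[n]`. -/
def fixCount {n : ℕ} (σ : Equiv.Perm (Fin n)) : ℕ :=
  ((Finset.Icc 1 n).filter fun i => permToFun σ i = i).card

/-- `exc σ`: the number of excedances of a permutation of `[n]`. -/
def excCount {n : ℕ} (σ : Equiv.Perm (Fin n)) : ℕ :=
  ((Finset.Icc 1 n).filter fun i => i < permToFun σ i).card

/-- `DES σ`: the descent set of a permutation of `[n]`, a subset of `[n-1]`. -/
def desSet {n : ℕ} (σ : Equiv.Perm (Fin n)) : Finset ℕ :=
  (Finset.Icc 1 (n - 1)).filter fun i => permToFun σ (i + 1) < permToFun σ i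

/-- Each descent `i` yields a non-fixed point: `i` itself if it is an excedance, and otherwise
`i + 1`, which then satisfies `σ(i + 1) < i + 1`. This assignment is injective. -/
theorem card_desSet_le_card_nonfixed {n : ℕ} (σ : Equiv.Perm (Fin n)) :
    (desSet σ).card ≤ ((Finset.Icc 1 n).filter fun i => ¬ permToFun σ i = i).card := by
  apply Finset.card_le_card_of_injOn (fun i => if i < permToFun σ i then i else i + 1)
  · intro i hi
    simp only [desSet, Finset.coe_filter, Finset.mem_Icc, Set.mem_ofPred_eq] at hi ⊢
    split_ifs <;> omega
  · intro i hi j hj hij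
    simp only [desSet, Finset.coe_filter, Finset.mem_Icc, Set.mem_ofPred_eq] at hi hj hij
    split_ifs at hij
    · exact hij
    · subst hij; omega
    · subst hij; omega
    · omega

/-- If `σ` is a permutation of `[n]` with `DES σ = J ⊆ [n-1]`,
then `fix σ ≤ n - |J|`. -/
theorem fix_le_of_desSet_eq (n : ℕ) (hn : 0 < n) (J : Finset ℕ)
    (hJ : J ⊆ Finset.Icc 1 (n - 1)) (σ : Equiv.Perm (Fin n)) (hσ : desSet σ = J) :
    fixCount σ ≤ n - J.card := by
  subst hσ
  have hcard := Finset.card_filter_add_card_filter_not (s := Finset.Icc 1 n)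
    (fun i => permToFun σ i = i)
  have hle := card_desSet_le_card_nonfixed σ
  rw [Nat.card_Icc] at hcard
  unfold fixCount
  omega
end

section
/- Let n be a positive integer and J a subset of [n−1]. Let F_n(J) be the set of permutations σ of [n] with DES σ = J and fix σ = n − |J|, and let G(J) be the set of derangements τ of the set J such that τ(i) > τ(i+1) whenever both i and i+1 belong to J. Then for every nonnegative integer m, #{σ ∈ F_n(J) : exc σ = m} = #{τ ∈ G(J) : exc τ = m}; equivalently, Σ_{σ∈F_n(J)} s^{exc σ} = Σ_{τ∈G(J)} s^{exc τ} as polynomials in s. -/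
/-- `exc τ` for a bijection `τ` of a finite set `J` of positive integers. -/
def excOn (J : Finset ℕ) (τ : Equiv.Perm {x // x ∈ J}) : ℕ :=
  (Finset.univ.filter fun j : {x // x ∈ J} => (j : ℕ) < (τ j : ℕ)).card

/-- For `j ∈ J` and `t` a derangement of `J` that decreases along consecutive elements of `J`,
the position of `j` after a fixed point has been inserted into each maximal run of `J`: the
excedances stay in place and the other elements are shifted by one. -/
def fixShift (t : ℕ → ℕ) (j : ℕ) : ℕ := if j < t j then j else j + 1

/-- The function `s` fixes everything outside the image of `J` under `fixShift t`, and acts on this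
image as `t` does on `J`. -/
def IsFixInsertion (J : Finset ℕ) (t s : ℕ → ℕ) : Prop :=
  (∀ j ∈ J, s (fixShift t j) = fixShift t (t j)) ∧
    ∀ i, (∀ j ∈ J, fixShift t j ≠ i) → s i = i

/-- A derangement of `J`, extended by the identity, that decreases along consecutive elements
of `J`. -/
structure IsDescendingDerangement (J : Finset ℕ) (t : ℕ → ℕ) : Prop where
  injective : Function.Injective t
  eq_of_notMem : ∀ j ∉ J, t j = j
  ne_of_mem : ∀ j ∈ J, t j ≠ j
  lt_of_mem : ∀ j ∈ J, j + 1 ∈ J → t (j + 1) < t j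

/-- A permutation of `[n]`, extended by the identity, with descent set `J` and
`n - |J|` fixed points. -/
structure IsMaxFixedPerm (n : ℕ) (J : Finset ℕ) (s : ℕ → ℕ) : Prop where
  injective : Function.Injective s
  eq_of_notMem : ∀ i ∉ Finset.Icc 1 n, s i = i
  mem_iff : ∀ i ∈ Finset.Icc 1 (n - 1), i ∈ J ↔ s (i + 1) < s i
  card_fixed : ((Finset.Icc 1 n).filter fun i => s i = i).card = n - J.card

theorem mem_of_injective_of_eq_of_notMem {S : Finset ℕ} {f : ℕ → ℕ}
    (hf : Function.Injective f) (h : ∀ i ∉ S, f i = i) {i : ℕ} (hi : i ∈ S) : f i ∈ S := by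
  by_contra hc
  exact hc ((hf (h _ hc)).symm ▸ hi)

section Derangement

variable {J : Finset ℕ} {t : ℕ → ℕ}

theorem IsDescendingDerangement.mem (ht : IsDescendingDerangement J t) {j : ℕ} (hj : j ∈ J) :
    t j ∈ J :=
  mem_of_injective_of_eq_of_notMem ht.injective ht.eq_of_notMem hj

theorem IsDescendingDerangement.fixShift_lt (ht : IsDescendingDerangement J t) {i j : ℕ}
    (hi : i ∈ J) (hj : j ∈ J) (hij : i < j) : fixShift t i < fixShift t j := by
  have h1 := ht.lt_of_mem i hi
  by_cases h : j = i + 1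
  · subst h
    have h2 := h1 hj
    unfold fixShift
    split_ifs <;> omega
  · unfold fixShift
    split_ifs <;> omega

theorem IsDescendingDerangement.fixShift_inj (ht : IsDescendingDerangement J t) {i j : ℕ}
    (hi : i ∈ J) (hj : j ∈ J) (h : fixShift t i = fixShift t j) : i = j := by
  rcases lt_trichotomy i j with h' | h' | h'
  · exact absurd h (ht.fixShift_lt hi hj h').ne
  · exact h'
  · exact absurd h (ht.fixShift_lt hj hi h').ne'

variable {s : ℕ → ℕ}

/-- The values of a fixed point insertion, according to the type of the position. -/
theorem IsFixInsertion.cases (ht : IsDescendingDerangement J t) (h : IsFixInsertion J t s) (i : ℕ) :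
    (i ∈ J ∧ i < t i ∧ s i = fixShift t (t i) ∧ i < s i) ∨
    (∃ j ∈ J, i = j + 1 ∧ t j < j ∧ s i = fixShift t (t j) ∧ s i < i) ∨
    ((∀ j ∈ J, fixShift t j ≠ i) ∧ s i = i) := by
  by_cases hi : ∀ j ∈ J, fixShift t j ≠ i
  · exact .inr (.inr ⟨hi, h.2 i hi⟩)
  push Not at hi
  obtain ⟨j, hj, rfl⟩ := hi
  have h1 := h.1 j hj
  rcases lt_or_gt_of_ne (ht.ne_of_mem j hj) with hlt | hlt
  · have h2 := ht.fixShift_lt (ht.mem hj) hj hlt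
    refine .inr (.inl ⟨j, hj, ?_, hlt, h1, h1 ▸ h2⟩)
    simp [fixShift, hlt.le]
  · have h2 := ht.fixShift_lt hj (ht.mem hj) hlt
    have h3 : fixShift t j = j := by simp [fixShift, hlt]
    rw [h3] at h1 h2 ⊢
    exact .inl ⟨hj, hlt, h1, h1 ▸ h2⟩

theorem IsFixInsertion.lt_iff (ht : IsDescendingDerangement J t) (h : IsFixInsertion J t s) (i : ℕ) :
    i < s i ↔ i ∈ J ∧ i < t i := by
  rcases h.cases ht i with ⟨h1, h2, -, h4⟩ | ⟨j, hj, rfl, h2, -, h4⟩ | ⟨h1, h2⟩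
  · simp [h1, h2, h4]
  · refine iff_of_false h4.le.not_gt fun ⟨h5, h6⟩ => ?_
    have := ht.lt_of_mem j hj h5
    omega
  · refine iff_of_false (by omega) fun ⟨h5, h6⟩ => h1 i h5 ?_
    simp [fixShift, h6]

theorem IsFixInsertion.eq_iff (ht : IsDescendingDerangement J t) (h : IsFixInsertion J t s) (i : ℕ) :
    s i = i ↔ i ∉ J.image (fixShift t) := by
  refine ⟨fun hs hi => ?_, fun hi => h.2 i fun j hj he => hi (Finset.mem_image.2 ⟨j, hj, he⟩)⟩
  obtain ⟨j, hj, rfl⟩ := Finset.mem_image.1 hi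
  rw [h.1 j hj] at hs
  exact ht.ne_of_mem j hj (ht.fixShift_inj (ht.mem hj) hj hs)

theorem IsFixInsertion.injective (ht : IsDescendingDerangement J t) (h : IsFixInsertion J t s) :
    Function.Injective s := by
  have key : ∀ j ∈ J, ∀ b, s (fixShift t j) = s b → fixShift t j = b := by
    intro j hj b hab
    by_cases hb : ∀ k ∈ J, fixShift t k ≠ b
    · rw [h.2 b hb, h.1 j hj] at hab
      exact absurd hab (hb _ (ht.mem hj))
    · push Not at hb
      obtain ⟨k, hk, rfl⟩ := hb
      rw [h.1 j hj, h.1 k hk] at hab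
      rw [ht.injective (ht.fixShift_inj (ht.mem hj) (ht.mem hk) hab)]
  intro a b hab
  by_cases ha : ∀ k ∈ J, fixShift t k ≠ a
  · by_cases hb : ∀ k ∈ J, fixShift t k ≠ b
    · rwa [h.2 a ha, h.2 b hb] at hab
    · push Not at hb
      obtain ⟨k, hk, rfl⟩ := hb
      exact (key k hk a hab.symm).symm
  · push Not at ha
    obtain ⟨k, hk, rfl⟩ := ha
    exact key k hk b hab

theorem IsFixInsertion.mem_iff_descent (ht : IsDescendingDerangement J t)
    (h : IsFixInsertion J t s) (i : ℕ) : i ∈ J ↔ s (i + 1) < s i := by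
  have hinj : s (i + 1) ≠ s i := fun he => by simpa using h.injective ht he
  rcases h.cases ht i with ⟨h1, h2, h3, h4⟩ | ⟨j, hj, hij, h2, h3, h4⟩ | ⟨h1, h2⟩ <;>
  rcases h.cases ht (i + 1) with ⟨k1, k2, k3, k4⟩ | ⟨k, hk, hik, k2, k3, k4⟩ | ⟨k1, k2⟩
  · refine iff_of_true h1 ?_
    rw [h3, k3]
    exact ht.fixShift_lt (ht.mem k1) (ht.mem h1) (ht.lt_of_mem i h1 k1)
  · obtain rfl : i = k := by omega
    omega
  · exact iff_of_true h1 (by omega)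
  · refine iff_of_false (fun hi => ?_) (by omega)
    have := ht.lt_of_mem i hi k1
    have := ht.lt_of_mem j hj (hij ▸ hi)
    subst hij
    omega
  · obtain rfl : i = k := by omega
    refine iff_of_true hk ?_
    rw [h3, k3]
    subst hij
    exact ht.fixShift_lt (ht.mem hk) (ht.mem hj) (ht.lt_of_mem j hj hk)
  · refine iff_of_false (fun hi => ?_) (by omega)
    refine k1 i hi ?_
    have := ht.lt_of_mem j hj (hij ▸ hi)
    subst hij
    unfold fixShift
    split_ifs <;> omega
  · refine iff_of_false (fun hi => h1 i hi ?_) (by omega)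
    have := ht.lt_of_mem i hi k1
    unfold fixShift
    split_ifs <;> omega
  · obtain rfl : i = k := by omega
    exact iff_of_true hk (by omega)
  · refine iff_of_false (fun hi => ?_) (by omega)
    have h3 := h1 i hi
    have h4 := k1 i hi
    unfold fixShift at h3 h4
    split_ifs at h3 h4 <;> omega

theorem IsFixInsertion.isMaxFixedPerm {n : ℕ} (hJ : J ⊆ Finset.Icc 1 (n - 1))
    (ht : IsDescendingDerangement J t) (h : IsFixInsertion J t s) : IsMaxFixedPerm n J s := by
  have hsub : J.image (fixShift t) ⊆ Finset.Icc 1 n := by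
    intro i hi
    obtain ⟨j, hj, rfl⟩ := Finset.mem_image.1 hi
    have := Finset.mem_Icc.1 (hJ hj)
    rw [Finset.mem_Icc]
    unfold fixShift
    split_ifs <;> omega
  refine ⟨h.injective ht, fun i hi => (h.eq_iff ht i).2 fun hi' => hi (hsub hi'),
    fun i _ => h.mem_iff_descent ht i, ?_⟩
  have hcard : (J.image (fixShift t)).card = J.card :=
    Finset.card_image_of_injOn fun i hi j hj he => ht.fixShift_inj hi hj he
  have hset : ((Finset.Icc 1 n).filter fun i => s i = i) =
      Finset.Icc 1 n \ J.image (fixShift t) := by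
    ext i
    rw [Finset.mem_filter, Finset.mem_sdiff, h.eq_iff ht]
  rw [hset, Finset.card_sdiff_of_subset hsub, hcard, Nat.card_Icc, Nat.add_sub_cancel]

theorem IsFixInsertion.filter_lt_eq {n : ℕ} (hJ : J ⊆ Finset.Icc 1 (n - 1))
    (ht : IsDescendingDerangement J t) (h : IsFixInsertion J t s) :
    ((Finset.Icc 1 n).filter fun i => i < s i) = J.filter fun j => j < t j := by
  ext i
  rw [Finset.mem_filter, Finset.mem_filter, h.lt_iff ht]
  refine ⟨And.right, fun hi => ⟨?_, hi⟩⟩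
  have := Finset.mem_Icc.1 (hJ hi.1)
  rw [Finset.mem_Icc]
  omega

theorem exists_isFixInsertion (ht : IsDescendingDerangement J t) :
    ∃ s, IsFixInsertion J t s := by
  classical
  refine ⟨fun i => if h : ∃ j ∈ J, fixShift t j = i then fixShift t (t h.choose) else i, ?_, ?_⟩
  · intro j hj
    have h : ∃ k ∈ J, fixShift t k = fixShift t j := ⟨j, hj, rfl⟩
    simp only [dif_pos h]
    rw [ht.fixShift_inj h.choose_spec.1 hj h.choose_spec.2]
  · intro i hi
    refine dif_neg ?_
    push Not
    exact hi

theorem IsFixInsertion.unique {s' : ℕ → ℕ} (h : IsFixInsertion J t s)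
    (h' : IsFixInsertion J t s') : s = s' := by
  funext i
  by_cases hi : ∀ j ∈ J, fixShift t j ≠ i
  · rw [h.2 i hi, h'.2 i hi]
  · push Not at hi
    obtain ⟨j, hj, rfl⟩ := hi
    rw [h.1 j hj, h'.1 j hj]

theorem IsFixInsertion.unique_derangement {t' : ℕ → ℕ} (ht : IsDescendingDerangement J t)
    (ht' : IsDescendingDerangement J t') (h : IsFixInsertion J t s)
    (h' : IsFixInsertion J t' s) : t = t' := by
  have hshift : ∀ j ∈ J, fixShift t j = fixShift t' j := by
    intro j hj
    have h1 := h.lt_iff ht j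
    have h2 := h'.lt_iff ht' j
    have h3 : j < t j ↔ j < t' j := by tauto
    simp only [fixShift, h3]
  funext j
  by_cases hj : j ∈ J
  · have h1 := h.1 j hj
    rw [hshift j hj, h'.1 j hj, ← hshift _ (ht'.mem hj)] at h1
    exact (ht.fixShift_inj (ht'.mem hj) (ht.mem hj) h1).symm
  · rw [ht.eq_of_notMem j hj, ht'.eq_of_notMem j hj]

end Derangement

section MaxFixed

variable {n : ℕ} {J : Finset ℕ} {s : ℕ → ℕ}

theorem IsMaxFixedPerm.descent (hJ : J ⊆ Finset.Icc 1 (n - 1)) (hs : IsMaxFixedPerm n J s)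
    {j : ℕ} (hj : j ∈ J) : s (j + 1) < s j :=
  (hs.mem_iff j (hJ hj)).1 hj

theorem IsMaxFixedPerm.fixShift_lt (hJ : J ⊆ Finset.Icc 1 (n - 1)) (hs : IsMaxFixedPerm n J s)
    {i j : ℕ} (hi : i ∈ J) (hij : i < j) : fixShift s i < fixShift s j := by
  have h1 := hs.descent hJ hi
  by_cases h : j = i + 1
  · subst h
    unfold fixShift
    split_ifs <;> omega
  · unfold fixShift
    split_ifs <;> omega

theorem IsMaxFixedPerm.fixShift_lt_iff (hJ : J ⊆ Finset.Icc 1 (n - 1))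
    (hs : IsMaxFixedPerm n J s) {i j : ℕ} (hi : i ∈ J) (hj : j ∈ J) :
    fixShift s i < fixShift s j ↔ i < j := by
  refine ⟨fun h => ?_, hs.fixShift_lt hJ hi⟩
  rcases lt_trichotomy i j with h' | rfl | h'
  · exact h'
  · exact absurd h (lt_irrefl _)
  · exact absurd h (hs.fixShift_lt hJ hj h').le.not_gt

theorem IsMaxFixedPerm.fixShift_inj (hJ : J ⊆ Finset.Icc 1 (n - 1)) (hs : IsMaxFixedPerm n J s)
    {i j : ℕ} (hi : i ∈ J) (hj : j ∈ J) (h : fixShift s i = fixShift s j) : i = j := by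
  have h1 := hs.fixShift_lt_iff hJ hi hj
  have h2 := hs.fixShift_lt_iff hJ hj hi
  omega

theorem IsMaxFixedPerm.lt_apply_fixShift_iff (hJ : J ⊆ Finset.Icc 1 (n - 1))
    (hs : IsMaxFixedPerm n J s) {j : ℕ} (hj : j ∈ J) :
    fixShift s j < s (fixShift s j) ↔ j < s j := by
  have h1 := hs.descent hJ hj
  by_cases h : j < s j
  · simp [fixShift, h]
  · simp only [fixShift, h, if_false, iff_false]
    omega

theorem IsMaxFixedPerm.apply_fixShift_ne (hJ : J ⊆ Finset.Icc 1 (n - 1))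
    (hs : IsMaxFixedPerm n J s) {j : ℕ} (hj : j ∈ J) : s (fixShift s j) ≠ fixShift s j := by
  have h1 := hs.descent hJ hj
  by_cases h : j < s j
  · simp only [fixShift, h, if_true]
    omega
  · simp only [fixShift, h, if_false]
    omega

/-- Every point moved by `s` comes from `J`: the two sets have the same number of elements. -/
theorem IsMaxFixedPerm.exists_fixShift_eq (hJ : J ⊆ Finset.Icc 1 (n - 1))
    (hs : IsMaxFixedPerm n J s) {i : ℕ} (hi : s i ≠ i) : ∃ j ∈ J, fixShift s j = i := by
  have hsub : J.image (fixShift s) ⊆ (Finset.Icc 1 n).filter fun i => ¬ s i = i := by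
    intro i hi
    obtain ⟨j, hj, rfl⟩ := Finset.mem_image.1 hi
    refine Finset.mem_filter.2 ⟨by_contra fun h => ?_, hs.apply_fixShift_ne hJ hj⟩
    exact hs.apply_fixShift_ne hJ hj (hs.eq_of_notMem _ h)
  have hcard : (J.image (fixShift s)).card = J.card :=
    Finset.card_image_of_injOn fun i hi j hj he => hs.fixShift_inj hJ hi hj he
  have h1 := Finset.card_filter_add_card_filter_not (s := Finset.Icc 1 n) (fun i => s i = i)
  have h2 := hs.card_fixed
  have h3 := Finset.card_le_card hJ
  rw [Nat.card_Icc] at h1 h3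
  have heq := Finset.eq_of_subset_of_card_le hsub (by omega)
  have hmem : i ∈ J.image (fixShift s) := by
    rw [heq, Finset.mem_filter]
    exact ⟨by_contra fun h => hi (hs.eq_of_notMem i h), hi⟩
  exact Finset.mem_image.1 hmem

theorem IsMaxFixedPerm.exists_derangement (hJ : J ⊆ Finset.Icc 1 (n - 1))
    (hs : IsMaxFixedPerm n J s) : ∃ t, IsDescendingDerangement J t ∧ IsFixInsertion J t s := by
  classical
  have hex : ∀ j, ∃ k, (j ∈ J → k ∈ J ∧ fixShift s k = s (fixShift s j)) ∧ (j ∉ J → k = j) := by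
    intro j
    by_cases hj : j ∈ J
    · obtain ⟨k, hk, he⟩ := hs.exists_fixShift_eq hJ
        (fun h => hs.apply_fixShift_ne hJ hj (hs.injective h))
      exact ⟨k, fun _ => ⟨hk, he⟩, fun h => absurd hj h⟩
    · exact ⟨j, fun h => absurd h hj, fun _ => rfl⟩
  choose t ht ht' using hex
  have hlt : ∀ j ∈ J, (j < t j ↔ j < s j) := fun j hj => by
    rw [← hs.lt_apply_fixShift_iff hJ hj, ← (ht j hj).2, hs.fixShift_lt_iff hJ hj (ht j hj).1]
  have hshift : ∀ j ∈ J, fixShift t j = fixShift s j := fun j hj => by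
    simp only [fixShift, hlt j hj]
  refine ⟨t, ⟨?_, ht', ?_, ?_⟩, ?_, ?_⟩
  · intro a b hab
    by_cases ha : a ∈ J <;> by_cases hb : b ∈ J
    · refine hs.fixShift_inj hJ ha hb (hs.injective ?_)
      rw [← (ht a ha).2, ← (ht b hb).2, hab]
    · exact absurd (ht' b hb ▸ hab ▸ (ht a ha).1) hb
    · exact absurd (ht' a ha ▸ hab ▸ (ht b hb).1) ha
    · rw [← ht' a ha, ← ht' b hb, hab]
  · intro j hj he
    refine hs.apply_fixShift_ne hJ hj ?_
    rw [← (ht j hj).2, he]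
  · intro j hj hj1
    rw [← hs.fixShift_lt_iff hJ (ht _ hj1).1 (ht j hj).1, (ht _ hj1).2, (ht j hj).2]
    have h1 := hs.descent hJ hj
    have h2 := hs.descent hJ hj1
    unfold fixShift
    split_ifs <;> omega
  · intro j hj
    rw [hshift j hj, hshift _ (ht j hj).1, (ht j hj).2]
  · intro i hi
    by_contra hne
    obtain ⟨j, hj, he⟩ := hs.exists_fixShift_eq hJ hne
    exact hi j hj (hshift j hj ▸ he)

end MaxFixed

theorem permToFun_of_notMem {n : ℕ} (σ : Equiv.Perm (Fin n)) {i : ℕ}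
    (hi : i ∉ Finset.Icc 1 n) : permToFun σ i = i :=
  dif_neg (by rwa [Finset.mem_Icc] at hi)

theorem permToFun_succ {n : ℕ} (σ : Equiv.Perm (Fin n)) (i : Fin n) :
    permToFun σ (i + 1) = σ i + 1 := by
  rw [permToFun, dif_pos ⟨by omega, by omega⟩]
  rfl

theorem permToFun_injective {n : ℕ} (σ : Equiv.Perm (Fin n)) :
    Function.Injective (permToFun σ) := by
  intro a b hab
  unfold permToFun at hab
  split_ifs at hab with h1 h2 h2
  · have h3 := σ.injective (Fin.ext (by omega) : σ ⟨a - 1, by omega⟩ = σ ⟨b - 1, by omega⟩)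
    rw [Fin.mk.injEq] at h3
    omega
  · omega
  · omega
  · exact hab

theorem permToFun_inj {n : ℕ} {σ σ' : Equiv.Perm (Fin n)} (h : permToFun σ = permToFun σ') :
    σ = σ' := by
  ext i
  have h1 := congrFun h (i + 1)
  rw [permToFun_succ, permToFun_succ] at h1
  omega

theorem exists_permToFun_eq {n : ℕ} {s : ℕ → ℕ} (hs : Function.Injective s)
    (h : ∀ i ∉ Finset.Icc 1 n, s i = i) : ∃ σ : Equiv.Perm (Fin n), permToFun σ = s := by
  have hmem : ∀ i : Fin n, 1 ≤ s (i + 1) ∧ s (i + 1) ≤ n := fun i =>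
    Finset.mem_Icc.1 (mem_of_injective_of_eq_of_notMem hs h (Finset.mem_Icc.2 (by omega)))
  let f : Fin n → Fin n := fun i => ⟨s (i + 1) - 1, by have := hmem i; omega⟩
  have hf : Function.Injective f := by
    intro a b hab
    have h1 : s (a + 1) - 1 = s (b + 1) - 1 := congrArg Fin.val hab
    have h2 := hmem a
    have h3 := hmem b
    have h4 := hs (by omega : s (a + 1) = s (b + 1))
    omega
  refine ⟨Equiv.ofBijective f (Finite.injective_iff_bijective.1 hf), funext fun i => ?_⟩
  by_cases hi : i ∈ Finset.Icc 1 n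
  · obtain ⟨h1, h2⟩ := Finset.mem_Icc.1 hi
    have h3 : permToFun _ (i - 1 + 1) = s (i - 1 + 1) - 1 + 1 := permToFun_succ
      (Equiv.ofBijective f (Finite.injective_iff_bijective.1 hf)) ⟨i - 1, by omega⟩
    have h4 := (hmem ⟨i - 1, by omega⟩).1
    rw [Fin.val_mk] at h4
    rwa [Nat.sub_add_cancel h4, Nat.sub_add_cancel h1] at h3
  · rw [permToFun_of_notMem _ hi, h i hi]

theorem isMaxFixedPerm_permToFun_iff {n : ℕ} {J : Finset ℕ} (hJ : J ⊆ Finset.Icc 1 (n - 1))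
    (σ : Equiv.Perm (Fin n)) :
    IsMaxFixedPerm n J (permToFun σ) ↔ desSet σ = J ∧ fixCount σ = n - J.card := by
  constructor
  · intro h
    refine ⟨?_, h.card_fixed⟩
    ext i
    rw [desSet, Finset.mem_filter]
    exact ⟨fun hi => (h.mem_iff i hi.1).2 hi.2, fun hi => ⟨hJ hi, (h.mem_iff i (hJ hi)).1 hi⟩⟩
  · rintro ⟨h1, h2⟩
    refine ⟨permToFun_injective σ, fun i => permToFun_of_notMem σ, fun i hi => ?_, h2⟩
    rw [← h1, desSet, Finset.mem_filter]
    exact and_iff_right hi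

section ExtendId

variable {J : Finset ℕ}

/-- The extension of a permutation of `J` by the identity. -/
def extendId (τ : Equiv.Perm {x // x ∈ J}) (j : ℕ) : ℕ :=
  if h : j ∈ J then τ ⟨j, h⟩ else j

theorem extendId_of_mem (τ : Equiv.Perm {x // x ∈ J}) {j : ℕ} (h : j ∈ J) :
    extendId τ j = τ ⟨j, h⟩ :=
  dif_pos h

theorem extendId_of_notMem (τ : Equiv.Perm {x // x ∈ J}) {j : ℕ} (h : j ∉ J) :
    extendId τ j = j :=
  dif_neg h

theorem extendId_injective (τ : Equiv.Perm {x // x ∈ J}) : Function.Injective (extendId τ) := by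
  intro a b hab
  unfold extendId at hab
  split_ifs at hab with h1 h2 h2
  · simpa using τ.injective (Subtype.ext hab)
  · exact absurd (hab ▸ (τ ⟨a, h1⟩).2) h2
  · exact absurd (hab ▸ (τ ⟨b, h2⟩).2) h1
  · exact hab

theorem extendId_inj {τ τ' : Equiv.Perm {x // x ∈ J}} (h : extendId τ = extendId τ') :
    τ = τ' := by
  ext j
  have h1 := congrFun h j
  rwa [extendId_of_mem τ j.2, extendId_of_mem τ' j.2] at h1

theorem exists_extendId_eq {t : ℕ → ℕ} (ht : Function.Injective t) (h : ∀ j ∉ J, t j = j) :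
    ∃ τ : Equiv.Perm {x // x ∈ J}, extendId τ = t := by
  let f : {x // x ∈ J} → {x // x ∈ J} :=
    fun j => ⟨t j, mem_of_injective_of_eq_of_notMem ht h j.2⟩
  have hf : Function.Injective f := fun a b hab =>
    Subtype.ext (ht (congrArg Subtype.val hab))
  refine ⟨Equiv.ofBijective f (Finite.injective_iff_bijective.1 hf), funext fun j => ?_⟩
  by_cases hj : j ∈ J
  · rw [extendId_of_mem _ hj]
    rfl
  · rw [extendId_of_notMem _ hj, h j hj]

theorem isDescendingDerangement_extendId_iff (τ : Equiv.Perm {x // x ∈ J}) :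
    IsDescendingDerangement J (extendId τ) ↔
      (∀ j, τ j ≠ j) ∧ ∀ (i : ℕ) (hi : i ∈ J) (hi1 : i + 1 ∈ J),
        (τ ⟨i + 1, hi1⟩ : ℕ) < (τ ⟨i, hi⟩ : ℕ) := by
  constructor
  · intro h
    refine ⟨fun j he => h.ne_of_mem j j.2 ?_, fun i hi hi1 => ?_⟩
    · rw [extendId_of_mem τ j.2]
      exact congrArg Subtype.val he
    · have := h.lt_of_mem i hi hi1
      rwa [extendId_of_mem τ hi, extendId_of_mem τ hi1] at this
  · rintro ⟨h1, h2⟩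
    refine ⟨extendId_injective τ, fun j => extendId_of_notMem τ, fun j hj he => ?_,
      fun j hj hj1 => ?_⟩
    · rw [extendId_of_mem τ hj] at he
      exact h1 ⟨j, hj⟩ (Subtype.ext he)
    · rw [extendId_of_mem τ hj, extendId_of_mem τ hj1]
      exact h2 j hj hj1

theorem excOn_eq_card_filter (τ : Equiv.Perm {x // x ∈ J}) :
    excOn J τ = (J.filter fun j => j < extendId τ j).card := by
  refine Finset.card_bij (fun j _ => (j : ℕ)) (fun j hj => ?_) (fun a _ b _ h => Subtype.ext h)
    fun j hj => ?_
  · rw [Finset.mem_filter, extendId_of_mem τ j.2]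
    exact ⟨j.2, (Finset.mem_filter.1 hj).2⟩
  · obtain ⟨h1, h2⟩ := Finset.mem_filter.1 hj
    rw [extendId_of_mem τ h1] at h2
    exact ⟨⟨j, h1⟩, Finset.mem_filter.2 ⟨Finset.mem_univ _, h2⟩, rfl⟩

end ExtendId

theorem IsFixInsertion.excCount_eq {n : ℕ} {J : Finset ℕ} (hJ : J ⊆ Finset.Icc 1 (n - 1))
    {σ : Equiv.Perm (Fin n)} {τ : Equiv.Perm {x // x ∈ J}}
    (hτ : IsDescendingDerangement J (extendId τ))
    (h : IsFixInsertion J (extendId τ) (permToFun σ)) : excCount σ = excOn J τ := by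
  rw [excOn_eq_card_filter, excCount, h.filter_lt_eq hJ hτ]

/-- For `J ⊆ [n-1]`, let `F_n(J)` be the permutations of `[n]` with
`DES σ = J` and `fix σ = n - |J|`, and let `G(J)` be the derangements `τ` of the set `J`
with `τ(i) > τ(i+1)` whenever `i, i+1 ∈ J`.  Then for every `m`, the number of elements
of `F_n(J)` with `m` excedances equals the number of elements of `G(J)` with `m`
excedances. -/
theorem card_F_eq_card_G (n : ℕ) (hn : 0 < n) (J : Finset ℕ)
    (hJ : J ⊆ Finset.Icc 1 (n - 1)) (m : ℕ) :
    Nat.card {σ : Equiv.Perm (Fin n) //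
        desSet σ = J ∧ fixCount σ = n - J.card ∧ excCount σ = m}
      = Nat.card {τ : Equiv.Perm {x // x ∈ J} //
          (∀ j, τ j ≠ j) ∧
          (∀ (i : ℕ) (hi : i ∈ J) (hi1 : i + 1 ∈ J),
            (τ ⟨i + 1, hi1⟩ : ℕ) < (τ ⟨i, hi⟩ : ℕ)) ∧
          excOn J τ = m} := by
  have hF : ∀ x : {σ : Equiv.Perm (Fin n) //
      desSet σ = J ∧ fixCount σ = n - J.card ∧ excCount σ = m},
      ∃ y : {τ : Equiv.Perm {x // x ∈ J} //
          (∀ j, τ j ≠ j) ∧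
          (∀ (i : ℕ) (hi : i ∈ J) (hi1 : i + 1 ∈ J),
            (τ ⟨i + 1, hi1⟩ : ℕ) < (τ ⟨i, hi⟩ : ℕ)) ∧
          excOn J τ = m}, IsFixInsertion J (extendId y.1) (permToFun x.1) := by
    rintro ⟨σ, h1, h2, h3⟩
    obtain ⟨t, ht, hst⟩ :=
      ((isMaxFixedPerm_permToFun_iff hJ σ).2 ⟨h1, h2⟩).exists_derangement hJ
    obtain ⟨τ, rfl⟩ := exists_extendId_eq ht.injective ht.eq_of_notMem
    obtain ⟨h4, h5⟩ := (isDescendingDerangement_extendId_iff τ).1 ht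
    exact ⟨⟨τ, h4, h5, (hst.excCount_eq hJ ht).symm.trans h3⟩, hst⟩
  choose f hf using hF
  refine Nat.card_eq_of_bijective f ⟨fun x x' h => ?_, fun y => ?_⟩
  · have h' := hf x'
    rw [← h] at h'
    exact Subtype.ext (permToFun_inj ((hf x).unique h'))
  · obtain ⟨τ, h1, h2, h3⟩ := y
    have hτ := (isDescendingDerangement_extendId_iff τ).2 ⟨h1, h2⟩
    obtain ⟨s, hst⟩ := exists_isFixInsertion hτ
    have hs := hst.isMaxFixedPerm hJ hτ
    obtain ⟨σ, rfl⟩ := exists_permToFun_eq hs.injective hs.eq_of_notMem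
    obtain ⟨h4, h5⟩ := (isMaxFixedPerm_permToFun_iff hJ σ).1 hs
    refine ⟨⟨σ, h4, h5, (hst.excCount_eq hJ hτ).trans h3⟩, Subtype.ext (extendId_inj ?_)⟩
    refine (hf _).unique_derangement ?_ hτ hst
    exact (isDescendingDerangement_extendId_iff _).2 ⟨(f _).2.1, (f _).2.2.1⟩
end

section
/- For every integer n ≥ 2, d_n(2n) = d_{n+1}(2n+1) = d*_{n+1}(2n+1) = d*_{n+2}(2n+2) = D_n, where d_k(m) (resp. d*_k(m)) denotes the number of alternating (resp. reverse alternating) permutations of [m] with exactly k fixed points, and D_n denotes the number of derangements of [n]. -/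
/-- Alternating permutation: `π₁ > π₂ < π₃ > ⋯`, i.e. `DES π = {1,3,5,…} ∩ [n-1]`. -/
def IsAlternating {n : ℕ} (σ : Equiv.Perm (Fin n)) : Prop :=
  desSet σ = (Finset.Icc 1 (n - 1)).filter fun i => Odd i

/-- Reverse alternating permutation: `π₁ < π₂ > π₃ < ⋯`, i.e. `DES π = {2,4,6,…} ∩ [n-1]`. -/
def IsRevAlternating {n : ℕ} (σ : Equiv.Perm (Fin n)) : Prop :=
  desSet σ = (Finset.Icc 1 (n - 1)).filter fun i => Even i

theorem permToFun_add_one {n : ℕ} (σ : Equiv.Perm (Fin n)) (x : Fin n) :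
    permToFun σ (x + 1) = σ x + 1 := by
  simp [permToFun]

theorem fixCount_eq_card_filter {n : ℕ} (σ : Equiv.Perm (Fin n)) :
    fixCount σ = (Finset.univ.filter fun x => σ x = x).card := by
  symm
  apply Finset.card_bij (fun (x : Fin n) _ => (x : ℕ) + 1)
  · intro x hx
    have := x.isLt
    simp only [Finset.mem_filter, Finset.mem_univ, true_and, Finset.mem_Icc] at hx ⊢
    exact ⟨by omega, by rw [permToFun_add_one, hx]⟩
  · intro x _ y _ h
    ext
    simpa using h
  · intro k hk
    simp only [Finset.mem_filter, Finset.mem_Icc] at hk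
    obtain ⟨⟨h1, h2⟩, h3⟩ := hk
    obtain ⟨j, rfl⟩ : ∃ j, k = j + 1 := ⟨k - 1, by omega⟩
    refine ⟨⟨j, h2⟩, ?_, rfl⟩
    have := permToFun_add_one σ ⟨j, h2⟩
    simp only [Finset.mem_filter, Finset.mem_univ, true_and, Fin.ext_iff]
    simp only at this
    omega

theorem fixCount_add_card_support {n : ℕ} (σ : Equiv.Perm (Fin n)) :
    fixCount σ + σ.support.card = n := by
  rw [fixCount_eq_card_filter, Equiv.Perm.support, Finset.card_filter_add_card_filter_not]
  simp

theorem fixCount_eq_zero_iff {n : ℕ} (σ : Equiv.Perm (Fin n)) :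
    fixCount σ = 0 ↔ ∀ i, σ i ≠ i := by
  simp [fixCount_eq_card_filter, Finset.filter_eq_empty_iff]

theorem desSet_eq_filter_iff {n : ℕ} (σ : Equiv.Perm (Fin n)) (P : ℕ → Prop) [DecidablePred P] :
    desSet σ = (Finset.Icc 1 (n - 1)).filter P ↔
      ∀ p (h : p + 1 < n), σ ⟨p + 1, h⟩ < σ ⟨p, by omega⟩ ↔ P (p + 1) := by
  rw [desSet, Finset.filter_inj']
  have key (p : ℕ) (h : p + 1 < n) :
      permToFun σ (p + 1 + 1) < permToFun σ (p + 1) ↔ σ ⟨p + 1, h⟩ < σ ⟨p, by omega⟩ := by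
    have h1 := permToFun_add_one σ ⟨p, by omega⟩
    have h2 := permToFun_add_one σ ⟨p + 1, h⟩
    simp only at h1 h2
    rw [h1, h2, Fin.lt_def]
    omega
  constructor
  · intro H p h
    rw [← key p h]
    exact H (Finset.mem_Icc.2 ⟨by omega, by omega⟩)
  · intro H k hk
    obtain ⟨h1, h2⟩ := Finset.mem_Icc.1 hk
    obtain ⟨p, rfl⟩ : ∃ p, k = p + 1 := ⟨k - 1, by omega⟩
    rw [key p (by omega)]
    exact H p (by omega)

/-- For a permutation `τ` of `n` blocks of size two placed after the first `a` positions, the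
position in block `i` which is moved by `pairSpread`: the left one if `i` is an excedance of `τ`,
and the right one otherwise. -/
def pairPos {n m : ℕ} (a : ℕ) (h : a + 2 * n ≤ m) (τ : Equiv.Perm (Fin n)) : Fin n ↪ Fin m where
  toFun i := ⟨a + 2 * i + if i < τ i then 0 else 1, by split_ifs <;> omega⟩
  inj' i j hij := by
    simp only [Fin.mk.injEq] at hij
    ext
    split_ifs at hij <;> omega

/-- The permutation acting like `τ` on the positions `pairPos a h τ` and fixing all others. -/
def pairSpread {n m : ℕ} (a : ℕ) (h : a + 2 * n ≤ m) (τ : Equiv.Perm (Fin n)) :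
    Equiv.Perm (Fin m) :=
  τ.viaFintypeEmbedding (pairPos a h τ)

section pairSpread

variable {n m a : ℕ} {h : a + 2 * n ≤ m} {τ : Equiv.Perm (Fin n)}

theorem pairPos_val (i : Fin n) :
    (pairPos a h τ i : ℕ) = a + 2 * i + if i < τ i then 0 else 1 := rfl

theorem pairSpread_pairPos (i : Fin n) :
    pairSpread a h τ (pairPos a h τ i) = pairPos a h τ (τ i) :=
  Equiv.Perm.viaFintypeEmbedding_apply_image ..

theorem pairSpread_of_notMem_range {x : Fin m} (hx : x ∉ Set.range (pairPos a h τ)) :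
    pairSpread a h τ x = x :=
  Equiv.Perm.viaFintypeEmbedding_apply_notMem_range _ _ hx

theorem eq_of_forall_pairPos {σ : Equiv.Perm (Fin m)}
    (h1 : ∀ i, σ (pairPos a h τ i) = pairPos a h τ (τ i))
    (h2 : ∀ x ∉ Set.range (pairPos a h τ), σ x = x) : σ = pairSpread a h τ := by
  ext1 x
  by_cases hx : x ∈ Set.range (pairPos a h τ)
  · obtain ⟨i, rfl⟩ := hx
    rw [h1, pairSpread_pairPos]
  · rw [h2 x hx, pairSpread_of_notMem_range hx]

theorem support_pairSpread (hτ : ∀ i, τ i ≠ i) :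
    (pairSpread a h τ).support = Finset.univ.map (pairPos a h τ) := by
  ext x
  simp only [Equiv.Perm.mem_support, Finset.mem_map, Finset.mem_univ, true_and]
  constructor
  · intro hx
    by_contra hx'
    exact hx (pairSpread_of_notMem_range hx')
  · rintro ⟨i, rfl⟩
    rw [pairSpread_pairPos]
    exact fun hi => hτ i ((pairPos a h τ).injective hi)

theorem le_pairSpread (hτ : ∀ i, τ i ≠ i) {x : Fin m} (hx : Even ((x : ℕ) + a)) :
    x ≤ pairSpread a h τ x := by
  by_cases hr : x ∈ Set.range (pairPos a h τ)
  · obtain ⟨i, rfl⟩ := hr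
    rw [pairSpread_pairPos, Fin.le_def]
    simp only [pairPos_val] at hx ⊢
    have := Fin.val_ne_of_ne (hτ i)
    grind
  · rw [pairSpread_of_notMem_range hr]

theorem pairSpread_le (hτ : ∀ i, τ i ≠ i) {x : Fin m} (hx : ¬ Even ((x : ℕ) + a)) :
    pairSpread a h τ x ≤ x := by
  by_cases hr : x ∈ Set.range (pairPos a h τ)
  · obtain ⟨i, rfl⟩ := hr
    rw [pairSpread_pairPos, Fin.le_def]
    simp only [pairPos_val] at hx ⊢
    have := Fin.val_ne_of_ne (hτ i)
    grind
  · rw [pairSpread_of_notMem_range hr]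

theorem pairSpread_descent (hτ : ∀ i, τ i ≠ i) (i : Fin n) :
    pairSpread a h τ ⟨a + 2 * i + 1, by omega⟩ < pairSpread a h τ ⟨a + 2 * i, by omega⟩ := by
  have hi := Fin.val_ne_of_ne (hτ i)
  have hp := pairSpread_pairPos (h := h) (τ := τ) i
  have hv := pairPos_val (a := a) (h := h) (τ := τ) i
  have hw := pairPos_val (a := a) (h := h) (τ := τ) (τ i)
  by_cases hlt : i < τ i
  · have e1 : pairPos a h τ i = ⟨a + 2 * i, by omega⟩ := by
      ext; simp [hv, hlt]
    rw [e1] at hp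
    rw [hp, pairSpread_of_notMem_range, Fin.lt_def, hw]
    · simp only [Fin.lt_def] at hlt ⊢
      split_ifs <;> omega
    · rintro ⟨j, hj⟩
      have hj := congrArg Fin.val hj
      simp only [pairPos_val] at hj
      have : j = i := by ext; split_ifs at hj <;> omega
      subst this
      simp [hlt] at hj
  · have e1 : pairPos a h τ i = ⟨a + 2 * i + 1, by omega⟩ := by
      ext; simp [hv, hlt]
    rw [e1] at hp
    rw [hp, pairSpread_of_notMem_range, Fin.lt_def, hw]
    · simp only [Fin.lt_def] at hlt ⊢
      split_ifs <;> omega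
    · rintro ⟨j, hj⟩
      have hj := congrArg Fin.val hj
      simp only [pairPos_val] at hj
      have : j = i := by ext; split_ifs at hj <;> omega
      subst this
      simp [hlt] at hj

theorem pairSpread_lt_iff (ha : a ≤ 1) (hm : m ≤ a + 2 * n + 1) (hτ : ∀ i, τ i ≠ i) (p : ℕ)
    (hp : p + 1 < m) :
    pairSpread a h τ ⟨p + 1, hp⟩ < pairSpread a h τ ⟨p, by omega⟩ ↔ Even (p + a) := by
  by_cases he : Even (p + a)
  · simp only [he, iff_true]
    obtain ⟨k, hk⟩ := he
    obtain ⟨i, rfl⟩ : ∃ i, p = a + 2 * i := ⟨k - a, by omega⟩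
    exact pairSpread_descent hτ ⟨i, by omega⟩
  · simp only [he, iff_false, not_lt]
    have h1 := pairSpread_le (h := h) hτ (x := ⟨p, by omega⟩) he
    have h2 := le_pairSpread (h := h) hτ (x := ⟨p + 1, hp⟩)
      (by simp only; rw [Nat.even_iff] at *; omega)
    rw [Fin.le_def] at *
    simp only at *
    omega

variable (h) in
theorem pairSpread_injOn : Set.InjOn (pairSpread a h) {τ | ∀ i, τ i ≠ i} := by
  intro τ hτ τ' hτ' heq
  have hpos : pairPos a h τ = pairPos a h τ' := by
    ext i
    have hi : pairPos a h τ i ∈ (pairSpread a h τ').support := by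
      rw [← heq, support_pairSpread hτ]
      simp
    rw [support_pairSpread hτ'] at hi
    obtain ⟨j, -, hj⟩ := Finset.mem_map.1 hi
    have hv := congrArg Fin.val hj
    rw [pairPos_val, pairPos_val] at hv
    have : j = i := by ext; split_ifs at hv <;> omega
    rw [← hj, this]
  ext1 i
  apply (pairPos a h τ).injective
  rw [← pairSpread_pairPos, heq, hpos, pairSpread_pairPos]

variable (h) in
theorem exists_pairSpread_eq {σ : Equiv.Perm (Fin m)}
    (hσ : ∀ i : Fin n, σ ⟨a + 2 * i + 1, by omega⟩ < σ ⟨a + 2 * i, by omega⟩)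
    (hc : σ.support.card = n) :
    ∃ τ : Equiv.Perm (Fin n), (∀ i, τ i ≠ i) ∧ pairSpread a h τ = σ := by
  have hex (i : Fin n) : ∃ x : Fin m,
      ((x : ℕ) = a + 2 * i ∨ (x : ℕ) = a + 2 * i + 1) ∧ σ x ≠ x := by
    by_contra! hcon
    have h1 := hcon ⟨a + 2 * i, by omega⟩ (Or.inl rfl)
    have h2 := hcon ⟨a + 2 * i + 1, by omega⟩ (Or.inr rfl)
    have := hσ i
    rw [h1, h2, Fin.lt_def] at this
    simp only at this
    omega
  choose f hf hne using hex
  have finj : Function.Injective f := by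
    intro i j hij
    have h1 := hf i
    have h2 := hf j
    rw [hij] at h1
    ext
    omega
  have himg : Finset.univ.image f = σ.support := by
    apply Finset.eq_of_subset_of_card_le
    · intro x hx
      obtain ⟨i, -, rfl⟩ := Finset.mem_image.1 hx
      exact Equiv.Perm.mem_support.2 (hne i)
    · rw [hc, Finset.card_image_of_injective _ finj]
      simp
  have hmem (x : Fin m) : σ x ≠ x ↔ ∃ i, f i = x := by
    rw [← Equiv.Perm.mem_support, ← himg]
    simp
  have hstep (i : Fin n) : ∃ j, f j = σ (f i) :=
    (hmem _).1 fun hi => hne i (σ.injective hi)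
  choose t ht using hstep
  have tinj : Function.Injective t := fun i j hij =>
    finj (σ.injective (by rw [← ht, ← ht, hij]))
  let τ : Equiv.Perm (Fin n) := Equiv.ofBijective t (Finite.injective_iff_bijective.1 tinj)
  have hτ (i : Fin n) : τ i = t i := rfl
  have htne (i : Fin n) : τ i ≠ i := fun hi => hne i (by rw [← ht, ← hτ, hi])
  have hpos (i : Fin n) : f i = pairPos a h τ i := by
    have hi := Fin.val_ne_of_ne (htne i)
    have hd := hσ i
    have hft := hf (t i)
    rw [hτ] at hi
    ext
    rw [pairPos_val, hτ]
    rcases hf i with h0 | h0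
    · have e0 : f i = ⟨a + 2 * i, by omega⟩ := Fin.ext h0
      have e1 : σ ⟨a + 2 * i + 1, by omega⟩ = ⟨a + 2 * i + 1, by omega⟩ := by
        by_contra hcon
        obtain ⟨j, hj⟩ := (hmem _).1 hcon
        have hj' := congrArg Fin.val hj
        simp only at hj'
        have : j = i := by ext; have := hf j; omega
        subst this
        omega
      rw [e1, ← e0, ← ht, Fin.lt_def] at hd
      simp only at hd
      rw [if_pos (by rw [Fin.lt_def]; omega)]
      omega
    · have e0 : f i = ⟨a + 2 * i + 1, by omega⟩ := Fin.ext h0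
      have e1 : σ ⟨a + 2 * i, by omega⟩ = ⟨a + 2 * i, by omega⟩ := by
        by_contra hcon
        obtain ⟨j, hj⟩ := (hmem _).1 hcon
        have hj' := congrArg Fin.val hj
        simp only at hj'
        have : j = i := by ext; have := hf j; omega
        subst this
        omega
      rw [e1, ← e0, ← ht, Fin.lt_def] at hd
      simp only at hd
      rw [if_neg (by rw [Fin.lt_def]; omega)]
      omega
  refine ⟨τ, htne, (eq_of_forall_pairPos (fun i => ?_) fun x hx => ?_).symm⟩
  · rw [← hpos, ← hpos, hτ, ht]
  · by_contra hcon
    obtain ⟨i, rfl⟩ := (hmem x).1 hcon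
    exact hx ⟨i, (hpos i).symm⟩

end pairSpread

/-- Permutations of `[m]`, where `m = a + 2 * n + b` with `a, b ≤ 1`, whose descents are exactly
the first positions of the `n` blocks of size two following the first `a` positions, and with the
maximal number `a + n + b` of fixed points, are equinumerous with the derangements of `[n]`. -/
theorem card_desSet_eq_and_fixCount_eq {n m a : ℕ} (k : ℕ) (P : ℕ → Prop) [DecidablePred P]
    (ha : a ≤ 1) (h : a + 2 * n ≤ m) (hm : m ≤ a + 2 * n + 1) (hk : k + n = m)
    (hP : ∀ p, P (p + 1) ↔ Even (p + a)) :
    Nat.card {σ : Equiv.Perm (Fin m) //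
        desSet σ = (Finset.Icc 1 (m - 1)).filter P ∧ fixCount σ = k} =
      Nat.card {σ : Equiv.Perm (Fin n) // fixCount σ = 0} := by
  symm
  simp only [fixCount_eq_zero_iff, desSet_eq_filter_iff, hP]
  refine Nat.card_congr (Set.BijOn.equiv (pairSpread a h) ⟨?_, pairSpread_injOn h, ?_⟩)
  · intro τ hτ
    refine ⟨pairSpread_lt_iff ha hm hτ, ?_⟩
    have := fixCount_add_card_support (pairSpread a h τ)
    rw [support_pairSpread hτ, Finset.card_map, Finset.card_univ, Fintype.card_fin] at this
    omega
  · rintro σ ⟨hd, hf⟩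
    have := fixCount_add_card_support σ
    exact exists_pairSpread_eq h
      (fun i => (hd _ (by omega)).2 ⟨a + i, by omega⟩) (by omega)

/-- For `n ≥ 2`:
`d_n(2n) = d_{n+1}(2n+1) = d*_{n+1}(2n+1) = d*_{n+2}(2n+2) = D_n`,
where `d_k(m)` (resp. `d*_k(m)`) is the number of alternating (resp. reverse
alternating) permutations of `[m]` with exactly `k` fixed points and `D_n` is the
number of derangements of `[n]`. -/
theorem alternating_max_fix_eq_derangements (n : ℕ) (hn : 2 ≤ n) :
    Nat.card {σ : Equiv.Perm (Fin (2 * n)) // IsAlternating σ ∧ fixCount σ = n}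
        = Nat.card {σ : Equiv.Perm (Fin n) // fixCount σ = 0} ∧
      Nat.card {σ : Equiv.Perm (Fin (2 * n + 1)) // IsAlternating σ ∧ fixCount σ = n + 1}
        = Nat.card {σ : Equiv.Perm (Fin n) // fixCount σ = 0} ∧
      Nat.card {σ : Equiv.Perm (Fin (2 * n + 1)) // IsRevAlternating σ ∧ fixCount σ = n + 1}
        = Nat.card {σ : Equiv.Perm (Fin n) // fixCount σ = 0} ∧
      Nat.card {σ : Equiv.Perm (Fin (2 * n + 2)) // IsRevAlternating σ ∧ fixCount σ = n + 2}
        = Nat.card {σ : Equiv.Perm (Fin n) // fixCount σ = 0} := by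
  refine ⟨?_, ?_, ?_, ?_⟩
  · exact card_desSet_eq_and_fixCount_eq (a := 0) n Odd (by omega) (by omega) (by omega) (by omega)
      (by grind)
  · exact card_desSet_eq_and_fixCount_eq (a := 0) (n + 1) Odd (by omega) (by omega) (by omega)
      (by omega) (by grind)
  · exact card_desSet_eq_and_fixCount_eq (a := 1) (n + 1) Even (by omega) (by omega) (by omega)
      (by omega) (by simp)
  · exact card_desSet_eq_and_fixCount_eq (a := 1) (n + 2) Even (by omega) (by omega) (by omega)
      (by omega) (by simp)
end
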